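/- arXiv:1011.2479 — 2 statements merged into one kernel-verified Lean document; each statement's English description precedes it below -/
import Mathlib

section
/- Let δ, A, B, E, F, φ be real numbers with (δ²−1)AB + δ²F² ≥ 0, set R = √((δ²−1)AB + δ²F²), assume B·e^{−iφ}·F − 2ER ≠ 0 (and EFR ≠ 0), define a₁ = [2AEF e^{iφ} − R(R² + AB − F²)] / [2(BF e^{−iφ} − 2ER)], and assume cos φ = [B(R² + AB + F²) − 4AE²]/(4EFR). Set α = δ²−1, β = −δ², γ = 1 (so α + β + γ = 0), let m be a positive integer, and define Q : ℂ⁴ → ℂ by Q(w) = a₁(w¹)^{2m} + conj(a₁)(w²)^{2m} + E(w³)^{2m} + E(w⁴)^{2m} − A(w¹)^m(w²)^m + R(w¹)^m(w⁴)^m + R(w²)^m(w³)^m + B(w³)^m(w⁴)^m + F e^{iφ}(w¹)^m(w³)^m + F e^{−iφ}(w²)^m(w⁴)^m + C, for any real C. If u : U → ℂ is twice continuously differentiable on an open set U ⊆ ℂ⁴ with u(w) ≠ 0 and u(w)^{2m} = Q(w) on U, then u satisfies α u_{12}u_{34} + β u_{13}u_{24} + γ u_{14}u_{23} = 0 on U.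 (Under the identification (w¹,w²,w³,w⁴) = (z¹, z̄¹, z², z̄²) this is the real algebraic solution of the neutral-signature real heavenly equation (δ²−1)u_{1 1̄}u_{2 2̄} = δ²u_{12}u_{1̄ 2̄} − u_{1 2̄}u_{2 1̄}.) -/
/-!  Coordinates: `z : Fin 4 → ℂ` with paper indices `z¹,z²,z³,z⁴` corresponding to
`z 0, z 1, z 2, z 3`.  `pd i f` is the partial derivative ∂f/∂zⁱ. -/

/-- Partial derivative of `f : ℂ⁴ → ℂ` in the `i`-th coordinate direction. -/
noncomputable def pd (i : Fin 4) (f : (Fin 4 → ℂ) → ℂ) : (Fin 4 → ℂ) → ℂ :=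
  fun z => fderiv ℂ f z (Pi.single i 1)

theorem pd_of_has {f : (Fin 4 → ℂ) → ℂ} {f' : (Fin 4 → ℂ) →L[ℂ] ℂ} {z : Fin 4 → ℂ}
    (h : HasFDerivAt f f' z) (i : Fin 4) : pd i f z = f' (Pi.single i 1) := by
  unfold pd
  rw [h.fderiv]

theorem has_coord (n : ℕ) (k : Fin 4) (z : Fin 4 → ℂ) :
    HasFDerivAt (fun w : Fin 4 → ℂ => (w k) ^ (n + 1))
      ((((n : ℂ) + 1) * (z k) ^ n) • (ContinuousLinearMap.proj k : (Fin 4 → ℂ) →L[ℂ] ℂ)) z := by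
  have h := (hasFDerivAt_apply (𝕜 := ℂ) k z).pow (n + 1)
  refine h.congr_fderiv ?_
  ext v
  simp

/-- linear form -/
noncomputable def lf (h : Fin 4 → Fin 4 → ℂ) (n : ℕ) (j : Fin 4) (w : Fin 4 → ℂ) : ℂ :=
  h j 0 * (w 0) ^ (n + 1) + h j 1 * (w 1) ^ (n + 1) + h j 2 * (w 2) ^ (n + 1)
    + h j 3 * (w 3) ^ (n + 1)

noncomputable def qf (h : Fin 4 → Fin 4 → ℂ) (C : ℂ) (n : ℕ) (w : Fin 4 → ℂ) : ℂ :=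
  2⁻¹ * ((w 0) ^ (n + 1) * lf h n 0 w + (w 1) ^ (n + 1) * lf h n 1 w
    + (w 2) ^ (n + 1) * lf h n 2 w + (w 3) ^ (n + 1) * lf h n 3 w) + C

theorem has_lf (h : Fin 4 → Fin 4 → ℂ) (n : ℕ) (j : Fin 4) (z : Fin 4 → ℂ) :
    ∃ L : (Fin 4 → ℂ) →L[ℂ] ℂ, HasFDerivAt (lf h n j) L z ∧
      ∀ i, L (Pi.single i 1) = ((n : ℂ) + 1) * (z i) ^ n * h j i := by
  refine ⟨_, (((((has_coord n 0 z).const_mul (h j 0)).add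
    ((has_coord n 1 z).const_mul (h j 1))).add
    ((has_coord n 2 z).const_mul (h j 2))).add
    ((has_coord n 3 z).const_mul (h j 3))), ?_⟩
  intro i
  fin_cases i <;> simp [Pi.single_apply] <;> ring

theorem has_qf (h : Fin 4 → Fin 4 → ℂ) (hs : ∀ i j, h i j = h j i) (C : ℂ) (n : ℕ)
    (z : Fin 4 → ℂ) :
    ∃ L : (Fin 4 → ℂ) →L[ℂ] ℂ, HasFDerivAt (qf h C n) L z ∧
      ∀ i, L (Pi.single i 1) = ((n : ℂ) + 1) * (z i) ^ n * lf h n i z := by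
  obtain ⟨L0, h0, e0⟩ := has_lf h n 0 z
  obtain ⟨L1, h1, e1⟩ := has_lf h n 1 z
  obtain ⟨L2, h2, e2⟩ := has_lf h n 2 z
  obtain ⟨L3, h3, e3⟩ := has_lf h n 3 z
  refine ⟨_, ((((((has_coord n 0 z).mul h0).add ((has_coord n 1 z).mul h1)).add
    ((has_coord n 2 z).mul h2)).add ((has_coord n 3 z).mul h3)).const_mul 2⁻¹).add_const C, ?_⟩
  intro i
  have a1 := hs 1 0
  have a2 := hs 2 0
  have a3 := hs 3 0
  have a4 := hs 2 1
  have a5 := hs 3 1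
  have a6 := hs 3 2
  fin_cases i <;>
    simp [Pi.single_apply, e0, e1, e2, e3, lf, a1, a2, a3, a4, a5, a6] <;> ring

theorem second_pd (h : Fin 4 → Fin 4 → ℂ) (hs : ∀ i j, h i j = h j i) (C : ℂ) (n : ℕ)
    (U : Set (Fin 4 → ℂ)) (hU : IsOpen U)
    (u : (Fin 4 → ℂ) → ℂ) (hu : ContDiffOn ℂ 2 u U)
    (hsol : ∀ w ∈ U, u w ^ (2 * n + 2) = qf h C n w) (w : Fin 4 → ℂ) (hw : w ∈ U)
    (i j : Fin 4) (hij : i ≠ j) :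
    ((2 * n + 2 : ℂ) ^ 2 * u w ^ (2 * n + 2) * u w ^ (2 * n + 1)) * pd i (pd j u) w =
      ((n : ℂ) + 1) ^ 2 * (w i) ^ n * (w j) ^ n *
        ((2 * n + 2) * qf h C n w * h i j - (2 * n + 1) * lf h n i w * lf h n j w) := by
  have hd : ∀ z ∈ U, HasFDerivAt u (fderiv ℂ u z) z := fun z hz =>
    ((hu.differentiableOn (by norm_num)).differentiableAt (hU.mem_nhds hz)).hasFDerivAt
  have first : ∀ z ∈ U, ∀ k, (2 * n + 2 : ℂ) * u z ^ (2 * n + 1) * pd k u z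
      = ((n : ℂ) + 1) * (z k) ^ n * lf h n k z := by
    intro z hz k
    obtain ⟨L, hL, eL⟩ := has_qf h hs C n z
    have hev : (fun w => u w ^ (2 * n + 2)) =ᶠ[nhds z] qf h C n := by
      filter_upwards [hU.mem_nhds hz] with y hy using hsol y hy
    have h2 := ((hd z hz).pow (2 * n + 2)).congr_of_eventuallyEq hev.symm
    have h3 := hL.unique h2
    rw [← eL, h3]
    simp [pd]
  have hdd : DifferentiableAt ℂ (pd j u) w := by
    have h1 : ContDiffOn ℂ 1 (fderiv ℂ u) U := hu.fderiv_of_isOpen hU (by norm_num)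
    have h2 := (h1.differentiableOn (by norm_num)).differentiableAt (hU.mem_nhds hw)
    unfold pd
    exact h2.clm_apply (differentiableAt_const _)
  have hev : (fun z => ((2 * n + 2 : ℂ) * u z ^ (2 * n + 1)) * pd j u z) =ᶠ[nhds w]
      fun z => (((n : ℂ) + 1) * (z j) ^ n) * lf h n j z := by
    filter_upwards [hU.mem_nhds hw] with y hy using first y hy j
  obtain ⟨L, hL, eL⟩ := has_lf h n j w
  have hl := (((hd w hw).pow (2 * n + 1)).const_mul (2 * n + 2 : ℂ)).mul hdd.hasFDerivAt
  have hr := ((((hasFDerivAt_apply (𝕜 := ℂ) j w).pow n).const_mul ((n : ℂ) + 1)).mul hL)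
  have he := DFunLike.congr_fun ((hl.congr_of_eventuallyEq hev.symm).unique hr) (Pi.single i 1)
  have second : (2 * n + 2 : ℂ) * u w ^ (2 * n + 1) * pd i (pd j u) w
      + (2 * n + 2) * (2 * n + 1) * u w ^ (2 * n) * pd i u w * pd j u w
      = ((n : ℂ) + 1) ^ 2 * (w i) ^ n * (w j) ^ n * h i j := by
    simp [eL, Pi.single_apply, hij, hij.symm] at he
    rw [hs i j]
    simp only [pd] at he ⊢
    linear_combination he
  have fi := first w hw i
  have fj := first w hw j
  have hq := hsol w hw
  rw [← hq]
  have e : (2 * n + 2 : ℂ) ^ 2 * u w ^ (2 * n + 2) * u w ^ (2 * n) * pd i u w * pd j u w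
      = (((n : ℂ) + 1) * (w i) ^ n * lf h n i w) * (((n : ℂ) + 1) * (w j) ^ n * lf h n j w) := by
    rw [← fi, ← fj]; ring
  linear_combination (2 * n + 2 : ℂ) * u w ^ (2 * n + 2) * second - (2 * n + 1 : ℂ) * e

/-- Algebraic core. -/
theorem core (h11 h22 h33 h44 h12 h13 h14 h23 h24 h34 al be ga x1 x2 x3 x4 y1 y2 y3 y4 : ℂ)
    (hsum : al + be + ga = 0)
    (hP : al * h12 * h34 + be * h13 * h24 + ga * h14 * h23 = 0)
    (hy1 : y1 = h11 * x1 + h12 * x2 + h13 * x3 + h14 * x4)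
    (hy2 : y2 = h12 * x1 + h22 * x2 + h23 * x3 + h24 * x4)
    (hy3 : y3 = h13 * x1 + h23 * x2 + h33 * x3 + h34 * x4)
    (hy4 : y4 = h14 * x1 + h24 * x2 + h34 * x3 + h44 * x4)
    (m12 : h12 * (h33 * h44 - h34 * h34) - h23 * (h13 * h44 - h34 * h14)
      + h24 * (h13 * h34 - h33 * h14) = 0)
    (m13 : h12 * (h23 * h44 - h34 * h24) - h22 * (h13 * h44 - h34 * h14)
      + h24 * (h13 * h24 - h23 * h14) = 0)
    (m14 : h12 * (h23 * h34 - h33 * h24) - h22 * (h13 * h34 - h33 * h14)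
      + h23 * (h13 * h24 - h23 * h14) = 0)
    (m23 : h11 * (h23 * h44 - h34 * h24) - h12 * (h13 * h44 - h34 * h14)
      + h14 * (h13 * h24 - h23 * h14) = 0)
    (m24 : h11 * (h23 * h34 - h33 * h24) - h12 * (h13 * h34 - h33 * h14)
      + h13 * (h13 * h24 - h23 * h14) = 0)
    (m34 : h11 * (h22 * h34 - h23 * h24) - h12 * (h12 * h34 - h23 * h14)
      + h13 * (h12 * h24 - h22 * h14) = 0) :
    al * (h34 * y1 * y2 + h12 * y3 * y4) + be * (h24 * y1 * y3 + h13 * y2 * y4)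
      + ga * (h23 * y1 * y4 + h14 * y2 * y3) = 0 := by
  obtain ⟨q, hq⟩ : ∃ q, q = x1 * y1 + x2 * y2 + x3 * y3 + x4 * y4 := ⟨_, rfl⟩
  have N1 : q * (h12 * h34 - h13 * h24) - y2 * (y1 * h34 - h13 * y4)
      + y3 * (y1 * h24 - h12 * y4) = 0 := by
    rw [hq, hy1, hy2, hy3, hy4]
    linear_combination -(x1 * x2 * m34 + x2 * x4 * m13 + x1 * x3 * m24 + x3 * x4 * m12)
  have N2 : q * (h12 * h34 - h14 * h23) - y2 * (y1 * h34 - h14 * y3)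
      + y4 * (y1 * h23 - h12 * y3) = 0 := by
    rw [hq, hy1, hy2, hy3, hy4]
    linear_combination -x1 * x2 * m34 + x2 * x3 * m14 + x1 * x4 * m23 - x3 * x4 * m12
  linear_combination be * N1 + ga * N2 + q * hP
    + (h34 * y1 * y2 + h12 * y3 * y4 - q * h12 * h34) * hsum

theorem minors (A B E F R e f a b : ℂ) (hef : e * f = 1)
    (hD : B * F * f - 2 * E * R ≠ 0) (hD' : B * F * e - 2 * E * R ≠ 0)
    (r2 : 2 * E * F * R * (e + f) = B * (R ^ 2 + A * B + F ^ 2) - 4 * A * E ^ 2)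
    (r3 : 2 * a * (B * F * f - 2 * E * R) = 2 * A * E * F * e - R * (R ^ 2 + A * B - F ^ 2))
    (r4 : 2 * b * (B * F * e - 2 * E * R) = 2 * A * E * F * f - R * (R ^ 2 + A * B - F ^ 2))
    (al be ga x1 x2 x3 x4 y1 y2 y3 y4 : ℂ)
    (hsum : al + be + ga = 0)
    (hP : al * (-A) * B + be * (F * e) * (F * f) + ga * R * R = 0)
    (hy1 : y1 = (2 * a) * x1 + (-A) * x2 + (F * e) * x3 + R * x4)
    (hy2 : y2 = (-A) * x1 + (2 * b) * x2 + R * x3 + (F * f) * x4)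
    (hy3 : y3 = (F * e) * x1 + R * x2 + (2 * E) * x3 + B * x4)
    (hy4 : y4 = R * x1 + (F * f) * x2 + B * x3 + (2 * E) * x4) :
    al * (B * y1 * y2 + (-A) * y3 * y4) + be * ((F * f) * y1 * y3 + (F * e) * y2 * y4)
      + ga * (R * y1 * y4 + R * y2 * y3) = 0 := by
  have m13 : (-A) * (R * (2 * E) - B * (F * f)) - (2 * b) * ((F * e) * (2 * E) - B * R)
      + (F * f) * ((F * e) * (F * f) - R * R) = 0 := by
    apply mul_left_cancel₀ hD'
    linear_combination (-1) * (2 * E * F * e - B * R) * r4 + (R ^ 2 - F ^ 2) * r2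
      + (A * B ^ 2 * F ^ 2 - 4 * A * E ^ 2 * F ^ 2 + B * F ^ 2 * (F ^ 2 * (e * f + 1) - R ^ 2)
        - 2 * E * R * F ^ 3 * f) * hef
  have m14 : (-A) * (R * B - (2 * E) * (F * f)) - (2 * b) * ((F * e) * B - (2 * E) * R)
      + R * ((F * e) * (F * f) - R * R) = 0 := by
    linear_combination (-1) * r4 + R * F ^ 2 * hef
  have m23 : (2 * a) * (R * (2 * E) - B * (F * f)) - (-A) * ((F * e) * (2 * E) - B * R)
      + R * ((F * e) * (F * f) - R * R) = 0 := by
    linear_combination (-1) * r3 + R * F ^ 2 * hef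
  have m24 : (2 * a) * (R * B - (2 * E) * (F * f)) - (-A) * ((F * e) * B - (2 * E) * R)
      + (F * e) * ((F * e) * (F * f) - R * R) = 0 := by
    apply mul_left_cancel₀ hD
    linear_combination (-1) * (2 * E * F * f - B * R) * r3 + (R ^ 2 - F ^ 2) * r2
      + (A * B ^ 2 * F ^ 2 - 4 * A * E ^ 2 * F ^ 2 + B * F ^ 2 * (F ^ 2 * (e * f + 1) - R ^ 2)
        - 2 * E * R * F ^ 3 * e) * hef
  refine core (2 * a) (2 * b) (2 * E) (2 * E) (-A) (F * e) R R (F * f) B al be ga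
    x1 x2 x3 x4 y1 y2 y3 y4 hsum hP hy1 hy2 hy3 hy4 ?_ m13 m14 m23 m24 ?_
  · linear_combination (-1) * r2 + B * F ^ 2 * hef
  · apply mul_left_cancel₀ hD'
    linear_combination (-1) * (2 * a * B - F * e * R) * m14 + (-A * B - R * R) * m24

open Complex in
/-- the real algebraic solution (\ref{genersol}) of the neutral-signature
real heavenly equation, written in the coordinates `(w¹,w²,w³,w⁴) = (z¹,z̄¹,z²,z̄²)`:
with `α = δ²−1`, `β = −δ²`, `γ = 1`, any C² function `u` with `u ≠ 0` and `u^{2m} = Q`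
on `U` solves `α u₁₂u₃₄ + β u₁₃u₂₄ + γ u₁₄u₂₃ = 0` on `U`. -/
theorem real_algebraic_solution
    (δ A B E F φ C R : ℝ) (a1 : ℂ)
    (hnn : 0 ≤ (δ ^ 2 - 1) * A * B + δ ^ 2 * F ^ 2)
    (hR : R = Real.sqrt ((δ ^ 2 - 1) * A * B + δ ^ 2 * F ^ 2))
    (hden : (B : ℂ) * Complex.exp (-(Complex.I * φ)) * F - 2 * E * R ≠ 0)
    (hEFR : E * F * R ≠ 0)
    (ha1 : a1 = (2 * A * E * F * Complex.exp (Complex.I * φ)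
        - (R : ℂ) * ((R : ℂ) ^ 2 + A * B - F ^ 2))
      / (2 * ((B : ℂ) * F * Complex.exp (-(Complex.I * φ)) - 2 * E * R)))
    (hcos : Real.cos φ = (B * (R ^ 2 + A * B + F ^ 2) - 4 * A * E ^ 2) / (4 * E * F * R))
    (m : ℕ) (hm : 0 < m)
    (U : Set (Fin 4 → ℂ)) (hU : IsOpen U)
    (u : (Fin 4 → ℂ) → ℂ) (hu : ContDiffOn ℂ 2 u U)
    (hne : ∀ w ∈ U, u w ≠ 0)
    (hsol : ∀ w ∈ U, u w ^ (2 * m) =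
      a1 * (w 0) ^ (2 * m) + (starRingEnd ℂ) a1 * (w 1) ^ (2 * m)
        + (E : ℂ) * (w 2) ^ (2 * m) + (E : ℂ) * (w 3) ^ (2 * m)
        - (A : ℂ) * (w 0) ^ m * (w 1) ^ m
        + (R : ℂ) * (w 0) ^ m * (w 3) ^ m + (R : ℂ) * (w 1) ^ m * (w 2) ^ m
        + (B : ℂ) * (w 2) ^ m * (w 3) ^ m
        + (F : ℂ) * Complex.exp (Complex.I * φ) * (w 0) ^ m * (w 2) ^ m
        + (F : ℂ) * Complex.exp (-(Complex.I * φ)) * (w 1) ^ m * (w 3) ^ m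
        + (C : ℂ)) :
    ∀ w ∈ U,
      ((δ : ℂ) ^ 2 - 1) * pd 0 (pd 1 u) w * pd 2 (pd 3 u) w
        + (-(δ : ℂ) ^ 2) * pd 0 (pd 2 u) w * pd 1 (pd 3 u) w
        + 1 * pd 0 (pd 3 u) w * pd 1 (pd 2 u) w = 0 := by
  obtain ⟨n, rfl⟩ : ∃ n, m = n + 1 := ⟨m - 1, by omega⟩
  obtain ⟨e, he⟩ : ∃ e, e = Complex.exp (Complex.I * φ) := ⟨_, rfl⟩
  obtain ⟨f, hf⟩ : ∃ f, f = Complex.exp (-(Complex.I * φ)) := ⟨_, rfl⟩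
  have hef : e * f = 1 := by rw [he, hf, ← Complex.exp_add]; simp
  have hce : (starRingEnd ℂ) e = f := by
    rw [he, hf, ← Complex.exp_conj]; simp
  have hcf : (starRingEnd ℂ) f = e := by rw [← hce]; simp
  have hcos2 : e + f = 2 * (Real.cos φ : ℂ) := by
    rw [he, hf, Complex.ofReal_cos, Complex.cos]
    ring_nf
  rw [← he, ← hf] at ha1
  rw [← hf] at hden
  simp only [← he, ← hf] at hsol
  have hD : (B : ℂ) * F * f - 2 * E * R ≠ 0 := by
    intro h0; apply hden; linear_combination h0
  have hD' : (B : ℂ) * F * e - 2 * E * R ≠ 0 := by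
    intro h0; apply hD
    have := congrArg (starRingEnd ℂ) h0
    simpa [hce, map_ofNat] using this
  have r3 : 2 * a1 * ((B : ℂ) * F * f - 2 * E * R)
      = 2 * A * E * F * e - R * ((R : ℂ) ^ 2 + A * B - F ^ 2) := by
    have := (eq_div_iff (mul_ne_zero two_ne_zero hD)).1 ha1
    linear_combination this
  obtain ⟨b, hb⟩ : ∃ b, b = (starRingEnd ℂ) a1 := ⟨_, rfl⟩
  rw [← hb] at hsol
  have r4 : 2 * b * ((B : ℂ) * F * e - 2 * E * R)
      = 2 * A * E * F * f - R * ((R : ℂ) ^ 2 + A * B - F ^ 2) := by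
    have := congrArg (starRingEnd ℂ) r3
    simpa [hce, hcf, ← hb, map_ofNat] using this
  have r2 : 2 * (E : ℂ) * F * R * (e + f)
      = B * ((R : ℂ) ^ 2 + A * B + F ^ 2) - 4 * A * (E : ℂ) ^ 2 := by
    have h1 : 4 * E * F * R * Real.cos φ = B * (R ^ 2 + A * B + F ^ 2) - 4 * A * E ^ 2 := by
      have h4 : 4 * E * F * R ≠ 0 := by
        intro h0; apply hEFR; linear_combination h0 / 4
      rw [hcos, mul_div_cancel₀ _ h4]
    have h2 : (4 * E * F * R * (Real.cos φ : ℂ) : ℂ)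
        = B * ((R : ℂ) ^ 2 + A * B + F ^ 2) - 4 * A * (E : ℂ) ^ 2 := by exact_mod_cast h1
    rw [hcos2, ← h2]; ring
  have r1 : (R : ℂ) ^ 2 = ((δ : ℂ) ^ 2 - 1) * A * B + (δ : ℂ) ^ 2 * (F : ℂ) ^ 2 := by
    have : R ^ 2 = (δ ^ 2 - 1) * A * B + δ ^ 2 * F ^ 2 := by rw [hR, Real.sq_sqrt hnn]
    exact_mod_cast this
  intro w hw
  obtain ⟨h, hh⟩ : ∃ h : Fin 4 → Fin 4 → ℂ, h = ![![2 * a1, -A, F * e, R], ![-A, 2 * b, R, F * f],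
    ![F * e, R, 2 * E, B], ![R, F * f, B, 2 * E]] := ⟨_, rfl⟩
  have hs : ∀ i j, h i j = h j i := by
    intro i j
    rw [hh]
    fin_cases i <;> fin_cases j <;> rfl
  have hsol' : ∀ w ∈ U, u w ^ (2 * n + 2) = qf h C n w := by
    intro w hw
    have := hsol w hw
    rw [show 2 * n + 2 = 2 * (n + 1) by ring, this, hh]
    simp [qf, lf]
    ring
  have key := second_pd h hs C n U hU u hu hsol' w hw
  have k01 := key 0 1 (by decide)
  have k02 := key 0 2 (by decide)
  have k03 := key 0 3 (by decide)
  have k12 := key 1 2 (by decide)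
  have k13 := key 1 3 (by decide)
  have k23 := key 2 3 (by decide)
  have hc : (2 * n + 2 : ℂ) ^ 2 * u w ^ (2 * n + 2) * u w ^ (2 * n + 1) ≠ 0 := by
    have h1 : (2 * n + 2 : ℂ) ≠ 0 := by exact_mod_cast (by omega : 2 * n + 2 ≠ 0)
    have := hne w hw
    positivity
  generalize (2 * n + 2 : ℂ) ^ 2 * u w ^ (2 * n + 2) * u w ^ (2 * n + 1) = c at *
  have hP : ((δ : ℂ) ^ 2 - 1) * (-A) * B + (-(δ : ℂ) ^ 2) * (F * e) * (F * f) + 1 * R * R = 0 := by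
    linear_combination r1 - (δ : ℂ) ^ 2 * F ^ 2 * hef
  have fin := minors A B E F R e f a1 b hef hD hD' r2 r3 r4 ((δ : ℂ) ^ 2 - 1) (-(δ : ℂ) ^ 2) 1
    ((w 0) ^ (n + 1)) ((w 1) ^ (n + 1)) ((w 2) ^ (n + 1)) ((w 3) ^ (n + 1))
    (lf h n 0 w) (lf h n 1 w) (lf h n 2 w) (lf h n 3 w) (by ring) hP
    (by rw [hh]; simp [lf]) (by rw [hh]; simp [lf]) (by rw [hh]; simp [lf]) (by rw [hh]; simp [lf])
  have e01 : h 0 1 = -A := by rw [hh]; rfl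
  have e02 : h 0 2 = F * e := by rw [hh]; rfl
  have e03 : h 0 3 = R := by rw [hh]; rfl
  have e12 : h 1 2 = R := by rw [hh]; rfl
  have e13 : h 1 3 = F * f := by rw [hh]; rfl
  have e23 : h 2 3 = B := by rw [hh]; rfl
  rw [e01] at k01
  rw [e02] at k02
  rw [e03] at k03
  rw [e12] at k12
  rw [e13] at k13
  rw [e23] at k23
  generalize lf h n 0 w = y0 at *
  generalize lf h n 1 w = y1 at *
  generalize lf h n 2 w = y2 at *
  generalize lf h n 3 w = y3 at *
  generalize qf h C n w = q at *
  generalize pd 0 (pd 1 u) w = p01 at *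
  generalize pd 0 (pd 2 u) w = p02 at *
  generalize pd 0 (pd 3 u) w = p03 at *
  generalize pd 1 (pd 2 u) w = p12 at *
  generalize pd 1 (pd 3 u) w = p13 at *
  generalize pd 2 (pd 3 u) w = p23 at *
  apply mul_left_cancel₀ (mul_ne_zero hc hc)
  have t : c * c * (((δ : ℂ) ^ 2 - 1) * p01 * p23 + (-(δ : ℂ) ^ 2) * p02 * p13 + 1 * p03 * p12)
    = ((δ : ℂ) ^ 2 - 1) * (c * p01) * (c * p23) + (-(δ : ℂ) ^ 2) * (c * p02) * (c * p13)
      + 1 * (c * p03) * (c * p12) := by ring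
  rw [t, k01, k02, k03, k12, k13, k23]
  linear_combination ((n : ℂ) + 1) ^ 4 * (w 0) ^ n * (w 1) ^ n * (w 2) ^ n * (w 3) ^ n *
    ((2 * n + 2) ^ 2 * q ^ 2 * hP - (2 * n + 2) * (2 * n + 1) * q * fin)
end

section
/- Let δ, A, B, E, F, φ be real numbers with (δ²−1)AB + δ²F² ≥ 0, set R = √((δ²−1)AB + δ²F²), assume BF e^{−iφ} − 2ER ≠ 0 and EFR ≠ 0, define a₁ = [2AEF e^{iφ} − R(R² + AB − F²)] / [2(BF e^{−iφ} − 2ER)], and assume cos φ = [B(R² + AB + F²) − 4AE²]/(4EFR). Then the 4×4 complex matrix M = [[2a₁, −A, F e^{iφ}, R], [−A, 2·conj(a₁), R, F e^{−iφ}], [F e^{iφ}, R, 2E, B], [R, F e^{−iφ}, B, 2E]] satisfies det M = 0, and moreover M has rank 2. Consequently the linear system M·(c₁, c̄₁, c₂, c̄₂)ᵀ = 0 of invariance conditions has a two-parameter family of nonzero solutions, so the algebraic solution of the real general heavenly equation is invariant under two independent point symmetries. -/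
theorem rank_two_aux (a b A B E F R e w K : ℂ) (hK : K * (4 * E ^ 2 - B ^ 2) = 1)
    (hew : e * w = 1)
    (h12 : -A * (4 * E ^ 2 - B ^ 2) = 2 * E * F * R * (e + w) - B * (F ^ 2 + R ^ 2))
    (h11 : 2 * a * (4 * E ^ 2 - B ^ 2) = 2 * E * F ^ 2 * e ^ 2 - 2 * B * F * R * e + 2 * E * R ^ 2)
    (h22 : 2 * b * (4 * E ^ 2 - B ^ 2) = 2 * E * F ^ 2 * w ^ 2 - 2 * B * F * R * w + 2 * E * R ^ 2) :
    Matrix.rank !![2 * a, -A, F * e, R; -A, 2 * b, R, F * w; F * e, R, 2 * E, B;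
      R, F * w, B, 2 * E] = 2 := by
  apply le_antisymm
  · have : !![2 * a, -A, F * e, R; -A, 2 * b, R, F * w; F * e, R, 2 * E, B;
      R, F * w, B, 2 * E] = !![K * (2 * E * F * e - B * R), K * (2 * E * R - B * F * e);
        K * (2 * E * R - B * F * w), K * (2 * E * F * w - B * R); 1, 0; 0, 1] *
        !![F * e, R, 2 * E, B; R, F * w, B, 2 * E] := by
      ext i j
      fin_cases i <;> fin_cases j <;> simp [Matrix.mul_apply, Fin.sum_univ_two]
      · linear_combination (-2 * a) * hK + K * h11
      · linear_combination A * hK + K * h12 + K * B * F ^ 2 * hew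
      · linear_combination (-F * e) * hK
      · linear_combination (-R) * hK
      · linear_combination A * hK + K * h12 + K * B * F ^ 2 * hew
      · linear_combination (-2 * b) * hK + K * h22
      · linear_combination (-R) * hK
      · linear_combination (-F * w) * hK
    rw [this]
    refine (Matrix.rank_mul_le_left _ _).trans ?_
    simpa using Matrix.rank_le_width (m := 4) (n := 2) _
  · set M := !![2 * a, -A, F * e, R; -A, 2 * b, R, F * w; F * e, R, 2 * E, B;
      R, F * w, B, 2 * E] with hM
    have hs : !![2 * E, B; B, 2 * E] =
        !![(0:ℂ), 0, 1, 0; 0, 0, 0, 1] * M * !![(0:ℂ), 0; 0, 0; 1, 0; 0, 1] := by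
      ext i j
      fin_cases i <;> fin_cases j <;> simp [hM, Matrix.mul_apply, Fin.sum_univ_four]
    have hu : IsUnit !![2 * E, B; B, 2 * E] := by
      rw [Matrix.isUnit_iff_isUnit_det, Matrix.det_fin_two_of, isUnit_iff_ne_zero]
      intro h
      have : K * (4 * E ^ 2 - B ^ 2) = 0 := by linear_combination K * h
      simp [this] at hK
    have h2 := Matrix.rank_of_isUnit _ hu
    rw [hs] at h2
    simp only [Fintype.card_fin] at h2
    rw [← h2]
    exact (Matrix.rank_mul_le_left _ _).trans (Matrix.rank_mul_le_right _ _)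

/-- the coefficient matrix `M` of the invariance conditions (\ref{invar})
of the general real algebraic solution has `det M = 0` and rank 2; consequently the
linear system `M·(c₁,c̄₁,c₂,c̄₂)ᵀ = 0` has a two-parameter family of nonzero solutions,
so the solution is invariant under two independent point symmetries. -/
theorem invariance_matrix_det_zero_rank_two
    (δ A B E F φ R : ℝ) (a1 : ℂ)
    (hnn : 0 ≤ (δ ^ 2 - 1) * A * B + δ ^ 2 * F ^ 2)
    (hR : R = Real.sqrt ((δ ^ 2 - 1) * A * B + δ ^ 2 * F ^ 2))
    (hden : (B : ℂ) * F * Complex.exp (-(Complex.I * φ)) - 2 * E * R ≠ 0)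
    (hEFR : E * F * R ≠ 0)
    (ha1 : a1 = (2 * A * E * F * Complex.exp (Complex.I * φ)
        - (R : ℂ) * ((R : ℂ) ^ 2 + A * B - F ^ 2))
      / (2 * ((B : ℂ) * F * Complex.exp (-(Complex.I * φ)) - 2 * E * R)))
    (hcos : Real.cos φ = (B * (R ^ 2 + A * B + F ^ 2) - 4 * A * E ^ 2) / (4 * E * F * R)) :
    Matrix.det
      !![2 * a1, -(A : ℂ), (F : ℂ) * Complex.exp (Complex.I * φ), (R : ℂ);
         -(A : ℂ), 2 * (starRingEnd ℂ) a1, (R : ℂ), (F : ℂ) * Complex.exp (-(Complex.I * φ));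
         (F : ℂ) * Complex.exp (Complex.I * φ), (R : ℂ), 2 * (E : ℂ), (B : ℂ);
         (R : ℂ), (F : ℂ) * Complex.exp (-(Complex.I * φ)), (B : ℂ), 2 * (E : ℂ)] = 0
    ∧
    Matrix.rank
      !![2 * a1, -(A : ℂ), (F : ℂ) * Complex.exp (Complex.I * φ), (R : ℂ);
         -(A : ℂ), 2 * (starRingEnd ℂ) a1, (R : ℂ), (F : ℂ) * Complex.exp (-(Complex.I * φ));
         (F : ℂ) * Complex.exp (Complex.I * φ), (R : ℂ), 2 * (E : ℂ), (B : ℂ);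
         (R : ℂ), (F : ℂ) * Complex.exp (-(Complex.I * φ)), (B : ℂ), 2 * (E : ℂ)] = 2 := by
  rw [and_iff_right_of_imp]
  · have hE : E ≠ 0 := by rintro rfl; simp at hEFR
    have hF : F ≠ 0 := by rintro rfl; simp at hEFR
    have hR0 : R ≠ 0 := by intro h; simp [h] at hEFR
    have hew : Complex.exp (Complex.I * φ) * Complex.exp (-(Complex.I * φ)) = 1 := by
      rw [← Complex.exp_add]; simp
    have hce : (starRingEnd ℂ) (Complex.exp (Complex.I * φ)) = Complex.exp (-(Complex.I * φ)) := by
      rw [← Complex.exp_conj]; simp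
    have hcw : (starRingEnd ℂ) (Complex.exp (-(Complex.I * φ))) = Complex.exp (Complex.I * φ) := by
      rw [← Complex.exp_conj]; simp
    have hc : ((Real.cos φ : ℝ) : ℂ) * 2
        = Complex.exp (Complex.I * φ) + Complex.exp (-(Complex.I * φ)) := by
      rw [Complex.ofReal_cos, Complex.cos, mul_comm Complex.I, neg_mul]; ring
    have hcos' : Real.cos φ * (4 * E * F * R) = B * (R ^ 2 + A * B + F ^ 2) - 4 * A * E ^ 2 := by
      rw [hcos]; field_simp
    have hcC : ((Real.cos φ : ℝ) : ℂ) * (4 * E * F * R)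
        = B * (R ^ 2 + A * B + F ^ 2) - 4 * A * E ^ 2 := by exact_mod_cast hcos'
    generalize Complex.exp (Complex.I * φ) = e at *
    generalize Complex.exp (-(Complex.I * φ)) = w at *
    have h12 : -(A:ℂ) * (4 * E ^ 2 - B ^ 2) = 2 * E * F * R * (e + w) - B * (F ^ 2 + R ^ 2) := by
      linear_combination (2 * E * F * R : ℂ) * hc - hcC
    have hden' : (B : ℂ) * F * e - 2 * E * R ≠ 0 := by
      intro h
      apply hden
      have := congrArg (starRingEnd ℂ) h
      simpa [hce, Complex.conj_ofNat] using this
    have hD : (4 * E ^ 2 - B ^ 2 : ℂ) ≠ 0 := by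
      intro h
      apply mul_ne_zero hden hden'
      linear_combination (B:ℂ) ^ 2 * F ^ 2 * hew + (B : ℂ) * h12 + (A * B + R ^ 2 : ℂ) * h
    have ha : 2 * a1 * (B * F * w - 2 * E * R) = 2 * A * E * F * e - R * (R ^ 2 + A * B - F ^ 2) := by
      rw [ha1, mul_comm (2:ℂ), mul_assoc]; exact div_mul_cancel₀ _ (mul_ne_zero two_ne_zero hden)
    have h11 : 2 * a1 * (4 * E ^ 2 - B ^ 2 : ℂ)
        = 2 * E * F ^ 2 * e ^ 2 - 2 * B * F * R * e + 2 * E * R ^ 2 := by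
      apply mul_right_cancel₀ hden
      linear_combination (4 * E ^ 2 - B ^ 2 : ℂ) * ha - (2 * E * F * e - B * R : ℂ) * h12
        + (-2 * E * B * F ^ 3 * e + 2 * B ^ 2 * F ^ 2 * R - 4 * E ^ 2 * F ^ 2 * R : ℂ) * hew
    have h22 : 2 * (starRingEnd ℂ) a1 * (4 * E ^ 2 - B ^ 2 : ℂ)
        = 2 * E * F ^ 2 * w ^ 2 - 2 * B * F * R * w + 2 * E * R ^ 2 := by
      have := congrArg (starRingEnd ℂ) h11
      simpa [hce, Complex.conj_ofNat] using this
    exact rank_two_aux a1 _ A B E F R e w _ (inv_mul_cancel₀ hD) hew h12 h11 h22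
  · intro h
    by_contra hd
    have := Matrix.rank_of_isUnit _ ((Matrix.isUnit_iff_isUnit_det _).2 (isUnit_iff_ne_zero.2 hd))
    rw [h] at this
    simp at this
end
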